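/- Let A be a C*-algebra and let I ⊆ A be a closed two-sided ideal. Then A is soft if and only if both I (regarded as a C*-algebra) and the quotient A/I are soft. -/

import Mathlib

/-!
Common definitions: softness for (non-unital) C*-algebras.

A C*-algebra is *soft* if it has no nonzero unital quotient; equivalently, for every
closed two-sided ideal `I` with `A/I ≠ 0`, the quotient `A/I` is not unital.
We encode properties of the quotient `A/I` intrinsically in `A`.
-/

variable {A : Type*}

/-- The quotient of `A` by the two-sided ideal `I` is unital: some `e ∈ A` represents
a multiplicative unit of `A/I`. -/
def QuotUnital [NonUnitalNonAssocRing A] (I : TwoSidedIdeal A) : Prop :=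
  ∃ e : A, ∀ x : A, x * e - x ∈ I ∧ e * x - x ∈ I

/-- The quotient of `A` by the two-sided ideal `I` is nonzero. -/
def QuotNonzero [NonUnitalNonAssocRing A] (I : TwoSidedIdeal A) : Prop :=
  ∃ x : A, x ∉ I

/-- A C*-algebra is *soft* if it has no nonzero unital quotient. -/
def IsSoftCStar (A : Type*) [NonUnitalNonAssocRing A] [TopologicalSpace A] : Prop :=
  ∀ I : TwoSidedIdeal A, IsClosed (I : Set A) → QuotNonzero I → ¬ QuotUnital I

/-- The topological closure of a two-sided ideal. -/
def TwoSidedIdeal.topologicalClosure [NonUnitalRing A] [TopologicalSpace A]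
    [IsTopologicalRing A] (I : TwoSidedIdeal A) : TwoSidedIdeal A :=
  TwoSidedIdeal.mk' (closure (I : Set A))
    (subset_closure I.zero_mem)
    (fun hx hy ↦ map_mem_closure₂ continuous_add hx hy fun _ ha _ hb ↦ I.add_mem ha hb)
    (fun hx ↦ map_mem_closure continuous_neg hx fun _ ha ↦ I.neg_mem ha)
    (fun {x _} hy ↦ map_mem_closure (continuous_const_mul x) hy
      fun _ ha ↦ I.mul_mem_left _ _ ha)
    (fun {_ y} hx ↦ map_mem_closure (f := fun z ↦ z * y) (continuous_mul_const y) hx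
      fun _ ha ↦ I.mul_mem_right _ _ ha)

theorem TwoSidedIdeal.coe_topologicalClosure [NonUnitalRing A] [TopologicalSpace A]
    [IsTopologicalRing A] (I : TwoSidedIdeal A) :
    (I.topologicalClosure : Set A) = closure (I : Set A) :=
  TwoSidedIdeal.coe_mk' ..

/-- For an ideal `J` of an ideal `I`, the largest ideal `K` of the ambient ring
with `I * K * I ⊆ J`. -/
def TwoSidedIdeal.sandwich [NonUnitalRing A] (I : TwoSidedIdeal A) (J : TwoSidedIdeal I) :
    TwoSidedIdeal A :=
  TwoSidedIdeal.mk'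
    {a | ∀ x y : I, (⟨x * a * y, I.mul_mem_left _ _ y.2⟩ : I) ∈ J}
    (fun x y ↦ by
      convert! J.zero_mem using 1
      exact Subtype.ext (by simp))
    (fun {a b} ha hb x y ↦ by
      convert! J.add_mem (ha x y) (hb x y) using 1
      exact Subtype.ext (by simp [mul_add, add_mul]))
    (fun {a} ha x y ↦ by
      convert! J.neg_mem (ha x y) using 1
      exact Subtype.ext (by simp))
    (fun {a b} hb x y ↦ by
      simpa [mul_assoc] using hb ⟨x * a, I.mul_mem_right _ _ x.2⟩ y)
    (fun {a b} ha x y ↦ by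
      simpa [mul_assoc] using ha x ⟨b * y, I.mul_mem_left _ _ y.2⟩)

theorem TwoSidedIdeal.mem_sandwich [NonUnitalRing A] {I : TwoSidedIdeal A}
    {J : TwoSidedIdeal I} {a : A} :
    a ∈ I.sandwich J ↔ ∀ x y : I, (⟨x * a * y, I.mul_mem_left _ _ y.2⟩ : I) ∈ J :=
  TwoSidedIdeal.mem_mk' ..

theorem TwoSidedIdeal.isClosed_sandwich [NonUnitalRing A] [TopologicalSpace A]
    [IsTopologicalRing A] (I : TwoSidedIdeal A) (J : TwoSidedIdeal I)
    (hJ : IsClosed (J : Set I)) : IsClosed (I.sandwich J : Set A) := by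
  have h : (I.sandwich J : Set A) =
      ⋂ (x : I) (y : I), (fun a : A ↦ (⟨x * a * y, I.mul_mem_left _ _ y.2⟩ : I)) ⁻¹' J := by
    ext a
    simp [TwoSidedIdeal.mem_sandwich]
  rw [h]
  exact isClosed_iInter fun x ↦ isClosed_iInter fun y ↦ hJ.preimage (by fun_prop)

/-- Closed ideals of a soft algebra are soft. -/
theorem IsSoftCStar.ideal [NonUnitalRing A] [TopologicalSpace A] [IsTopologicalRing A]
    (hA : IsSoftCStar A) (I : TwoSidedIdeal A) : IsSoftCStar I := by
  rintro J hJ ⟨x, hx⟩ ⟨e, he⟩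
  refine hA (I.sandwich J) (I.isClosed_sandwich J hJ) ⟨x, fun hxK ↦ hx ?_⟩ ⟨e, fun a ↦ ?_⟩
  · have hexe : e * x * e ∈ J := TwoSidedIdeal.mem_sandwich.1 hxK e e
    have h := J.sub_mem (J.sub_mem hexe (he (e * x)).1) (he x).2
    simpa using h
  · rw [TwoSidedIdeal.mem_sandwich, TwoSidedIdeal.mem_sandwich]
    constructor <;> intro y z
    · convert! J.mul_mem_left ⟨y * a, I.mul_mem_right _ _ y.2⟩ _ (he z).2 using 1
      exact Subtype.ext (by simp; noncomm_ring)
    · convert! J.mul_mem_right _ ⟨a * z, I.mul_mem_left _ _ z.2⟩ (he y).1 using 1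
      exact Subtype.ext (by simp; noncomm_ring)

/-- An element of norm less than one in a C*-algebra has a right quasi-inverse. -/
theorem exists_eq_add_mul_self_of_norm_lt_one [NonUnitalCStarAlgebra A] {x : A}
    (hx : ‖x‖ < 1) : ∃ y : A, y = x + x * y := by
  have h : IsUnit (1 + (-x : A) : Unitization ℂ A) := by
    rw [Unitization.inr_neg, ← sub_eq_add_neg]
    exact isUnit_one_sub_of_norm_lt_one (by rwa [Unitization.norm_inr])
  obtain ⟨y, hy, -⟩ := isQuasiregular_iff.1 ((isQuasiregular_iff_isUnit' ℂ).2 h)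
  refine ⟨y, ?_⟩
  rw [← sub_eq_zero, ← hy]
  noncomm_ring

/-- If `e` is a unit modulo `J`, then an ideal containing `J` whose closure contains `e`
already contains `e`. -/
theorem TwoSidedIdeal.mem_of_mem_closure_of_unit [NonUnitalCStarAlgebra A]
    {J K : TwoSidedIdeal A} (hJK : J ≤ K) {e : A} (he : ∀ x : A, x * e - x ∈ J ∧ e * x - x ∈ J)
    (heK : e ∈ closure (K : Set A)) : e ∈ K := by
  obtain ⟨k, hk, hek⟩ := Metric.mem_closure_iff.1 heK 1 one_pos
  rw [dist_eq_norm] at hek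
  obtain ⟨s, hs⟩ := exists_eq_add_mul_self_of_norm_lt_one hek
  have h₁ : k * (e + s) ∈ K := K.mul_mem_right _ _ hk
  have h₂ : e * e - e ∈ K := hJK (he e).1
  have h₃ : e * s - s ∈ K := hJK (he s).2
  have h₄ : (e - k) * e - (e - k) ∈ K := hJK (he (e - k)).1
  have key : e = k * (e + s) - (e * e - e) - (e * s - s) + ((e - k) * e - (e - k)) := by
    have h : s - (e - k) - (e - k) * s = 0 := by
      rw [sub_sub, ← hs, sub_self]
    rw [← sub_eq_zero, ← neg_eq_zero, ← h]
    noncomm_ring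
  rw [key]
  exact K.add_mem (K.sub_mem (K.sub_mem h₁ h₂) h₃) h₄

/-- For a closed two-sided ideal `I ⊆ A`: `A` is soft if and only if
`I` (as a C*-algebra) is soft and the quotient `A/I` is soft.  Softness of `A/I` is
expressed via the correspondence between closed two-sided ideals of `A/I` and closed
two-sided ideals of `A` containing `I` (under which `(A/I)/(J/I) ≅ A/J`). -/
theorem isSoftCStar_iff_ideal_and_quotient [NonUnitalCStarAlgebra A]
    (I : TwoSidedIdeal A) (hI : IsClosed (I : Set A)) :
    IsSoftCStar A ↔
      (IsSoftCStar I ∧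
        ∀ J : TwoSidedIdeal A, IsClosed (J : Set A) → (I : Set A) ⊆ (J : Set A) →
          QuotNonzero J → ¬ QuotUnital J) := by
  refine ⟨fun hA ↦ ⟨hA.ideal I, fun J hJ _ ↦ hA J hJ⟩, ?_⟩
  rintro ⟨hIsoft, hquot⟩ J hJ ⟨x, hx⟩ ⟨e, he⟩
  have hsup : e ∈ closure ((I ⊔ J : TwoSidedIdeal A) : Set A) := by
    by_contra hcon
    rw [← TwoSidedIdeal.coe_topologicalClosure] at hcon
    have hle : ((I ⊔ J : TwoSidedIdeal A) : Set A) ⊆ (I ⊔ J).topologicalClosure := by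
      rw [TwoSidedIdeal.coe_topologicalClosure]
      exact subset_closure
    refine hquot (I ⊔ J).topologicalClosure ?_
      (fun a ha ↦ hle (TwoSidedIdeal.mem_sup_left ha)) ⟨e, hcon⟩
      ⟨e, fun a ↦ ⟨hle (TwoSidedIdeal.mem_sup_right (he a).1),
        hle (TwoSidedIdeal.mem_sup_right (he a).2)⟩⟩
    rw [TwoSidedIdeal.coe_topologicalClosure]
    exact isClosed_closure
  obtain ⟨f, hf, j, hj, hfj⟩ := TwoSidedIdeal.mem_sup.1
    (TwoSidedIdeal.mem_of_mem_closure_of_unit le_sup_right he hsup)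
  have hfunit (a : A) : a * f - a ∈ J ∧ f * a - a ∈ J := by
    obtain rfl : f = e - j := eq_sub_of_add_eq hfj
    constructor
    · convert! J.sub_mem (he a).1 (J.mul_mem_left a j hj) using 1
      noncomm_ring
    · convert! J.sub_mem (he a).2 (J.mul_mem_right j a hj) using 1
      noncomm_ring
  let φ : I →ₙ+* A := NonUnitalSubringClass.subtype I
  have hφ (a : I) : a ∈ J.comap φ ↔ (a : A) ∈ J := TwoSidedIdeal.mem_comap φ
  refine hIsoft (J.comap φ) ?_ ⟨⟨f, hf⟩, fun hfJ ↦ hx ?_⟩ ⟨⟨f, hf⟩, fun a ↦ ?_⟩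
  · exact (Set.ext hφ : (J.comap φ : Set I) = Subtype.val ⁻¹' (J : Set A)) ▸
      hJ.preimage continuous_subtype_val
  · simpa using J.sub_mem (J.mul_mem_right _ x ((hφ _).1 hfJ)) (hfunit x).2
  · rw [hφ, hφ]
    exact hfunit a
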